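/- For every n ≥ 3, the secondary theta-seed Δ₂ := Σ_{σ} sgn(σ)·A_σ((θ_1 ξ_2 ρ_2 + θ_2 ξ_1 ρ_2 + θ_2 ξ_2 ρ_1)·θ_3 θ_4 ⋯ θ_{n−1}) (sum over all permutations σ of {1,…,n}; for n = 3 the product θ_3⋯θ_{n−1} is the empty product 1) is harmonic: Σ_{i=1}^n ∂_{θ_i}^h ∂_{ξ_i}^k ∂_{ρ_i}^ℓ Δ₂ = 0 for every (h,k,ℓ) ∈ {0,1}³ with h+k+ℓ > 0. -/

import Mathlib

noncomputable section

open ExteriorAlgebra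

/-- The underlying vector space: `Fin 3 × Fin n → ℚ`, with standard basis `e (j,i)`. -/
abbrev V (n : ℕ) : Type := (Fin 3 × Fin n) → ℚ

/-- Standard basis vector `e_{(j,i)}`. -/
def e (n : ℕ) (j : Fin 3) (i : Fin n) : V n := Pi.single (j, i) 1

/-- The exterior algebra `Λ` on three sets of `n` anticommuting variables. -/
abbrev Lam (n : ℕ) : Type := ExteriorAlgebra ℚ (V n)

/-- The variable `θ_i`. -/
def θ (n : ℕ) (i : Fin n) : Lam n := ExteriorAlgebra.ι ℚ (e n 0 i)

/-- The variable `ξ_i`. -/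
def ξ (n : ℕ) (i : Fin n) : Lam n := ExteriorAlgebra.ι ℚ (e n 1 i)

/-- The variable `ρ_i`. -/
def ρ (n : ℕ) (i : Fin n) : Lam n := ExteriorAlgebra.ι ℚ (e n 2 i)

/-- The algebra automorphism `A_σ` of `Λ` induced functorially by the linear automorphism
of `V` sending `e_{(j,i)}` to `e_{(j,σ(i))}`. -/
def A (n : ℕ) (σ : Equiv.Perm (Fin n)) : Lam n →ₐ[ℚ] Lam n :=
  ExteriorAlgebra.map (LinearMap.funLeft ℚ ℚ (fun p => (p.1, σ⁻¹ p.2)))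

/-- `f ∈ Λ` is antisymmetric if `A_σ f = sgn(σ) • f` for every permutation `σ`. -/
def IsAntisymmetric (n : ℕ) (f : Lam n) : Prop :=
  ∀ σ : Equiv.Perm (Fin n), A n σ f = ((Equiv.Perm.sign σ : ℤ) : ℚ) • f

/-- The contraction operator `∂_{θ_i}` (left contraction with the dual basis
functional of `e_{(0,i)}`). -/
def dθ (n : ℕ) (i : Fin n) : Module.End ℚ (Lam n) :=
  CliffordAlgebra.contractLeft (LinearMap.proj ((0 : Fin 3), i))

/-- The contraction operator `∂_{ξ_i}` (left contraction with the dual basis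
functional of `e_{(1,i)}`). -/
def dξ (n : ℕ) (i : Fin n) : Module.End ℚ (Lam n) :=
  CliffordAlgebra.contractLeft (LinearMap.proj ((1 : Fin 3), i))

/-- The contraction operator `∂_{ρ_i}` (left contraction with the dual basis
functional of `e_{(2,i)}`). -/
def dρ (n : ℕ) (i : Fin n) : Module.End ℚ (Lam n) :=
  CliffordAlgebra.contractLeft (LinearMap.proj ((2 : Fin 3), i))

/-- The differential operator `Σ_{i=1}^n ∂_{θ_i}^h ∘ ∂_{ξ_i}^k ∘ ∂_{ρ_i}^ℓ`. -/
def D (n : ℕ) (h k l : ℕ) : Module.End ℚ (Lam n) :=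
  ∑ i : Fin n, (dθ n i) ^ h * (dξ n i) ^ k * (dρ n i) ^ l

/-- `f ∈ Λ` is harmonic if `Σ_{i=1}^n ∂_{θ_i}^h ∂_{ξ_i}^k ∂_{ρ_i}^ℓ f = 0` for every
`(h,k,ℓ) ∈ {0,1}³` with `h + k + ℓ > 0`. -/
def IsHarmonic (n : ℕ) (f : Lam n) : Prop :=
  ∀ h k l : ℕ, h ≤ 1 → k ≤ 1 → l ≤ 1 → 0 < h + k + l → D n h k l f = 0

/-- The secondary theta-seed
`Δ₂ = Σ_σ sgn(σ) • A_σ((θ_1 ξ_2 ρ_2 + θ_2 ξ_1 ρ_2 + θ_2 ξ_2 ρ_1) θ_3 θ_4 ⋯ θ_{n-1})`. -/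
def Δ₂ (n : ℕ) (hn : 3 ≤ n) : Lam n :=
  ∑ σ : Equiv.Perm (Fin n), ((Equiv.Perm.sign σ : ℤ) : ℚ) •
    A n σ ((θ n ⟨0, by omega⟩ * ξ n ⟨1, by omega⟩ * ρ n ⟨1, by omega⟩ +
            θ n ⟨1, by omega⟩ * ξ n ⟨0, by omega⟩ * ρ n ⟨1, by omega⟩ +
            θ n ⟨1, by omega⟩ * ξ n ⟨1, by omega⟩ * ρ n ⟨0, by omega⟩) *
           (List.ofFn fun i : Fin (n - 3) =>
             θ n ⟨(i : ℕ) + 2, by have := i.isLt; omega⟩).prod)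

/-- The antisymmetrizer `∑ σ, sgn σ • A_σ`. -/
def antisymmetrizer (n : ℕ) : Lam n →ₗ[ℚ] Lam n :=
  ∑ σ : Equiv.Perm (Fin n), ((Equiv.Perm.sign σ : ℤ) : ℚ) • (A n σ).toLinearMap

theorem antisymmetrizer_apply (n : ℕ) (f : Lam n) :
    antisymmetrizer n f =
      ∑ σ : Equiv.Perm (Fin n), ((Equiv.Perm.sign σ : ℤ) : ℚ) • A n σ f := by
  simp [antisymmetrizer]

theorem A_ι (n : ℕ) (σ : Equiv.Perm (Fin n)) (v : V n) :
    A n σ (ι ℚ v) = ι ℚ (LinearMap.funLeft ℚ ℚ (fun p => (p.1, σ⁻¹ p.2)) v) := by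
  simp [A]

theorem A_mul (n : ℕ) (σ τ : Equiv.Perm (Fin n)) (f : Lam n) :
    A n (σ * τ) f = A n σ (A n τ f) := by
  have h : A n (σ * τ) = (A n σ).comp (A n τ) := by
    refine ExteriorAlgebra.hom_ext (LinearMap.ext fun v => ?_)
    change A n (σ * τ) (ι ℚ v) = A n σ (A n τ (ι ℚ v))
    rw [A_ι, A_ι, A_ι]
    rfl
  rw [h, AlgHom.comp_apply]

theorem funLeft_e (n : ℕ) (σ : Equiv.Perm (Fin n)) (j : Fin 3) (i : Fin n) :
    LinearMap.funLeft ℚ ℚ (fun p => (p.1, σ⁻¹ p.2)) (e n j i) = e n j (σ i) := by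
  ext ⟨j', i'⟩
  simp [e, LinearMap.funLeft, Pi.single_apply, Equiv.symm_apply_eq]

theorem A_θ (n : ℕ) (σ : Equiv.Perm (Fin n)) (i : Fin n) : A n σ (θ n i) = θ n (σ i) := by
  rw [θ, A_ι, funLeft_e, θ]

theorem A_ξ (n : ℕ) (σ : Equiv.Perm (Fin n)) (i : Fin n) : A n σ (ξ n i) = ξ n (σ i) := by
  rw [ξ, A_ι, funLeft_e, ξ]

theorem A_ρ (n : ℕ) (σ : Equiv.Perm (Fin n)) (i : Fin n) : A n σ (ρ n i) = ρ n (σ i) := by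
  rw [ρ, A_ι, funLeft_e, ρ]

theorem antisymmetrizer_A (n : ℕ) (τ : Equiv.Perm (Fin n)) (f : Lam n) :
    antisymmetrizer n (A n τ f) = ((Equiv.Perm.sign τ : ℤ) : ℚ) • antisymmetrizer n f := by
  rw [antisymmetrizer_apply, antisymmetrizer_apply, Finset.smul_sum]
  refine Fintype.sum_equiv (Equiv.mulRight τ) _ _ fun σ => ?_
  rcases Int.units_eq_one_or (Equiv.Perm.sign τ) with h | h <;>
    simp [A_mul, h]

theorem antisymmetrizer_add_swap {n : ℕ} {p q : Fin n} (hpq : p ≠ q) (f : Lam n) :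
    antisymmetrizer n f + antisymmetrizer n (A n (Equiv.swap p q) f) = 0 := by
  simp [antisymmetrizer_A, Equiv.Perm.sign_swap hpq]

theorem antisymmetrizer_eq_zero_of_swap {n : ℕ} {p q : Fin n} (hpq : p ≠ q) {f : Lam n}
    (hf : A n (Equiv.swap p q) f = f) : antisymmetrizer n f = 0 := by
  have h := antisymmetrizer_add_swap hpq f
  rw [hf, ← two_smul ℚ] at h
  exact (smul_eq_zero.mp h).resolve_left two_ne_zero

/-- Left contraction with a dual basis functional is equivariant under `A_σ`. -/
theorem A_contractLeft (n : ℕ) (σ : Equiv.Perm (Fin n)) (j : Fin 3) (i : Fin n) (f : Lam n) :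
    A n σ (CliffordAlgebra.contractLeft (LinearMap.proj (j, i)) f) =
      CliffordAlgebra.contractLeft (LinearMap.proj (j, σ i)) (A n σ f) := by
  induction f using CliffordAlgebra.left_induction with
  | algebraMap r => simp [AlgHom.commutes, CliffordAlgebra.contractLeft_algebraMap]
  | add x y hx hy => simp only [map_add, hx, hy]
  | ι_mul x v hx =>
    have hv : A n σ (CliffordAlgebra.ι 0 v) = CliffordAlgebra.ι 0
      (LinearMap.funLeft ℚ ℚ (fun p => (p.1, σ⁻¹ p.2)) v) := A_ι n σ v
    rw [map_mul (A n σ), hv, CliffordAlgebra.contractLeft_ι_mul,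
      CliffordAlgebra.contractLeft_ι_mul, map_sub, map_mul (A n σ), map_smul, hv, hx]
    simp [LinearMap.funLeft]

theorem A_dθ (n : ℕ) (σ : Equiv.Perm (Fin n)) (i : Fin n) (f : Lam n) :
    A n σ (dθ n i f) = dθ n (σ i) (A n σ f) := A_contractLeft n σ 0 i f

theorem A_dξ (n : ℕ) (σ : Equiv.Perm (Fin n)) (i : Fin n) (f : Lam n) :
    A n σ (dξ n i f) = dξ n (σ i) (A n σ f) := A_contractLeft n σ 1 i f

theorem A_dρ (n : ℕ) (σ : Equiv.Perm (Fin n)) (i : Fin n) (f : Lam n) :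
    A n σ (dρ n i f) = dρ n (σ i) (A n σ f) := A_contractLeft n σ 2 i f

theorem A_D (n : ℕ) (σ : Equiv.Perm (Fin n)) {h k l : ℕ} (hh : h ≤ 1) (hk : k ≤ 1) (hl : l ≤ 1)
    (f : Lam n) : A n σ (D n h k l f) = D n h k l (A n σ f) := by
  simp only [D, LinearMap.sum_apply, map_sum]
  rw [← Equiv.sum_comp σ (fun i => ((dθ n i) ^ h * (dξ n i) ^ k * (dρ n i) ^ l) (A n σ f))]
  refine Finset.sum_congr rfl fun i _ => ?_
  interval_cases h <;> interval_cases k <;> interval_cases l <;>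
    simp [A_dθ, A_dξ, A_dρ]

theorem D_antisymmetrizer (n : ℕ) {h k l : ℕ} (hh : h ≤ 1) (hk : k ≤ 1) (hl : l ≤ 1)
    (f : Lam n) : D n h k l (antisymmetrizer n f) = antisymmetrizer n (D n h k l f) := by
  simp only [antisymmetrizer_apply, map_sum, map_smul, A_D n _ hh hk hl]

section Contraction

variable {n : ℕ} (i k : Fin n) (f : Lam n)

theorem contractLeft_ι_e_mul (j j' : Fin 3) :
    CliffordAlgebra.contractLeft (LinearMap.proj (j, i)) (ι ℚ (e n j' k) * f) =
      (if j = j' ∧ i = k then f else 0) -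
        ι ℚ (e n j' k) * CliffordAlgebra.contractLeft (LinearMap.proj (j, i)) f := by
  refine (CliffordAlgebra.contractLeft_ι_mul _ _ _).trans ?_
  simp [e, Pi.single_apply, ExteriorAlgebra.ι]

theorem dθ_θ_mul : dθ n i (θ n k * f) = (if i = k then f else 0) - θ n k * dθ n i f := by
  simpa [dθ, θ] using contractLeft_ι_e_mul i k f 0 0

theorem dθ_ξ_mul : dθ n i (ξ n k * f) = -(ξ n k * dθ n i f) := by
  simpa [dθ, ξ] using contractLeft_ι_e_mul i k f 0 1

theorem dθ_ρ_mul : dθ n i (ρ n k * f) = -(ρ n k * dθ n i f) := by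
  simpa [dθ, ρ] using contractLeft_ι_e_mul i k f 0 2

theorem dξ_θ_mul : dξ n i (θ n k * f) = -(θ n k * dξ n i f) := by
  simpa [dξ, θ] using contractLeft_ι_e_mul i k f 1 0

theorem dξ_ξ_mul : dξ n i (ξ n k * f) = (if i = k then f else 0) - ξ n k * dξ n i f := by
  simpa [dξ, ξ] using contractLeft_ι_e_mul i k f 1 1

theorem dξ_ρ_mul : dξ n i (ρ n k * f) = -(ρ n k * dξ n i f) := by
  simpa [dξ, ρ] using contractLeft_ι_e_mul i k f 1 2

theorem dρ_θ_mul : dρ n i (θ n k * f) = -(θ n k * dρ n i f) := by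
  simpa [dρ, θ] using contractLeft_ι_e_mul i k f 2 0

theorem dρ_ξ_mul : dρ n i (ξ n k * f) = -(ξ n k * dρ n i f) := by
  simpa [dρ, ξ] using contractLeft_ι_e_mul i k f 2 1

theorem dρ_ρ_mul : dρ n i (ρ n k * f) = (if i = k then f else 0) - ρ n k * dρ n i f := by
  simpa [dρ, ρ] using contractLeft_ι_e_mul i k f 2 2

variable (p : Prop) [Decidable p]

theorem dθ_ite : dθ n i (if p then f else 0) = if p then dθ n i f else 0 := by
  split_ifs <;> simp

theorem dξ_ite : dξ n i (if p then f else 0) = if p then dξ n i f else 0 := by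
  split_ifs <;> simp

end Contraction

section ThetaProduct

variable {n : ℕ}

theorem dξ_prod_θ (i : Fin n) (t : List (Fin n)) : dξ n i (t.map (θ n)).prod = 0 := by
  induction t with
  | nil => exact CliffordAlgebra.contractLeft_one _ _
  | cons a t ih => simp [dξ_θ_mul, ih]

theorem dρ_prod_θ (i : Fin n) (t : List (Fin n)) : dρ n i (t.map (θ n)).prod = 0 := by
  induction t with
  | nil => exact CliffordAlgebra.contractLeft_one _ _
  | cons a t ih => simp [dρ_θ_mul, ih]

theorem dθ_prod_θ_of_notMem {i : Fin n} {t : List (Fin n)} (hi : i ∉ t) :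
    dθ n i (t.map (θ n)).prod = 0 := by
  induction t with
  | nil => exact CliffordAlgebra.contractLeft_one _ _
  | cons a t ih =>
    rw [List.mem_cons, not_or] at hi
    simp [dθ_θ_mul, ih hi.2, hi.1]

theorem A_swap_prod_θ {p q : Fin n} {t : List (Fin n)} (hp : p ∉ t) (hq : q ∉ t) :
    A n (Equiv.swap p q) (t.map (θ n)).prod = (t.map (θ n)).prod := by
  rw [map_list_prod, List.map_map]
  congr 1
  refine List.map_congr_left fun a ha => ?_
  rw [Function.comp_apply, A_θ, Equiv.swap_apply_of_ne_of_ne] <;> rintro rfl <;> contradiction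

theorem A_swap_dθ_prod_θ {i m : Fin n} {t : List (Fin n)} (ht : t.Nodup) (hm : m ∉ t) :
    A n (Equiv.swap i m) (dθ n i (t.map (θ n)).prod) = dθ n i (t.map (θ n)).prod := by
  induction t with
  | nil => rw [dθ_prod_θ_of_notMem List.not_mem_nil, map_zero]
  | cons a t ih =>
    rw [List.mem_cons, not_or] at hm
    rw [List.nodup_cons] at ht
    rw [List.map_cons, List.prod_cons, dθ_θ_mul]
    by_cases hia : i = a
    · subst hia
      simp [dθ_prod_θ_of_notMem ht.1, A_swap_prod_θ ht.1 hm.2]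
    · simp [hia, ih ht.2 hm.2, A_θ, Equiv.swap_apply_of_ne_of_ne (Ne.symm hia) (Ne.symm hm.1)]

end ThetaProduct

/-- The monomial sum underlying `Δ₂`, with arbitrary indices `a`, `b` in place of `1`, `2` and an
arbitrary list of trailing `θ` variables. -/
def secondarySeed {n : ℕ} (a b : Fin n) (t : List (Fin n)) : Lam n :=
  (θ n a * ξ n b * ρ n b + θ n b * ξ n a * ρ n b + θ n b * ξ n b * ρ n a) * (t.map (θ n)).prod

theorem antisymmetrizer_D_secondarySeed {n : ℕ} {a b m : Fin n} {t : List (Fin n)}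
    (hab : a ≠ b) (ham : a ≠ m) (hbm : b ≠ m) (ha : a ∉ t) (hb : b ∉ t) (hm : m ∉ t)
    (ht : t.Nodup) {h k l : ℕ} (hh : h ≤ 1) (hk : k ≤ 1) (hl : l ≤ 1) (hpos : 0 < h + k + l) :
    antisymmetrizer n (D n h k l (secondarySeed a b t)) = 0 := by
  have hP_ab := A_swap_prod_θ ha hb
  have hP_am := A_swap_prod_θ ha hm
  have hP_bm := A_swap_prod_θ hb hm
  have hb_am := Equiv.swap_apply_of_ne_of_ne hab.symm hbm
  have ha_bm := Equiv.swap_apply_of_ne_of_ne hab ham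
  have hdξ := fun i => dξ_prod_θ i t
  have hdρ := fun i => dρ_prod_θ i t
  have hdθ : ∀ i, antisymmetrizer n (θ n a * (ξ n b * (ρ n b * dθ n i (t.map (θ n)).prod))) = 0 ∧
      antisymmetrizer n (θ n b * (ξ n a * (ρ n b * dθ n i (t.map (θ n)).prod))) = 0 ∧
      antisymmetrizer n (θ n b * (ξ n b * (ρ n a * dθ n i (t.map (θ n)).prod))) = 0 := by
    intro i
    by_cases hi : i ∈ t
    · have hai : a ≠ i := by rintro rfl; contradiction
      have hbi : b ≠ i := by rintro rfl; contradiction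
      have him : i ≠ m := by rintro rfl; contradiction
      refine ⟨?_, ?_, ?_⟩ <;> refine antisymmetrizer_eq_zero_of_swap him ?_ <;>
        simp [A_θ, A_ξ, A_ρ, A_swap_dθ_prod_θ ht hm, Equiv.swap_apply_of_ne_of_ne hai ham,
          Equiv.swap_apply_of_ne_of_ne hbi hbm]
    · simp [dθ_prod_θ_of_notMem hi]
  have hdθa := dθ_prod_θ_of_notMem ha
  have hdθb := dθ_prod_θ_of_notMem hb
  rw [secondarySeed]
  generalize (t.map (θ n)).prod = P at *
  interval_cases h <;> interval_cases k <;> interval_cases l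
  · simp at hpos
  all_goals
    simp [D, add_mul, mul_assoc, dθ_θ_mul, dθ_ξ_mul, dθ_ρ_mul, dξ_θ_mul, dξ_ξ_mul, dξ_ρ_mul,
      dρ_θ_mul, dρ_ξ_mul, dρ_ρ_mul, hdξ, hdρ, Finset.sum_add_distrib,
      Finset.sum_sub_distrib, dθ_ite, dξ_ite, hab, hab.symm, hdθa, hdθb]
  · have h₁ := antisymmetrizer_add_swap hab (θ n a * (ξ n b * P))
    have h₂ : antisymmetrizer n (θ n b * (ξ n b * P)) = 0 :=
      antisymmetrizer_eq_zero_of_swap ham (by simp [A_θ, A_ξ, hP_am, hb_am])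
    simp only [map_mul, A_θ, A_ξ, hP_ab, Equiv.swap_apply_left, Equiv.swap_apply_right] at h₁
    rw [h₁, h₂, add_zero]
  · have h₁ := antisymmetrizer_add_swap hab (θ n a * (ρ n b * P))
    have h₂ : antisymmetrizer n (θ n b * (ρ n b * P)) = 0 :=
      antisymmetrizer_eq_zero_of_swap ham (by simp [A_θ, A_ρ, hP_am, hb_am])
    simp only [map_mul, A_θ, A_ρ, hP_ab, Equiv.swap_apply_left, Equiv.swap_apply_right] at h₁
    rw [h₂, neg_zero, add_zero, ← neg_add, h₁, neg_zero]
  · exact antisymmetrizer_eq_zero_of_swap hbm (by simp [A_θ, hP_bm, ha_bm])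
  · have h₁ := antisymmetrizer_add_swap hab (ξ n a * (ρ n b * P))
    have h₂ : antisymmetrizer n (ξ n b * (ρ n b * P)) = 0 :=
      antisymmetrizer_eq_zero_of_swap ham (by simp [A_ξ, A_ρ, hP_am, hb_am])
    simp only [map_mul, A_ξ, A_ρ, hP_ab, Equiv.swap_apply_left, Equiv.swap_apply_right] at h₁
    simpa [hdθ, h₂] using h₁
  · exact antisymmetrizer_eq_zero_of_swap hbm (by simp [A_ξ, hP_bm, ha_bm])
  · exact antisymmetrizer_eq_zero_of_swap hbm (by simp [A_ρ, hP_bm, ha_bm])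

/-- The secondary theta-seed `Δ₂` is harmonic. -/
theorem secondary_theta_seed_harmonic (n : ℕ) (hn : 3 ≤ n) : IsHarmonic n (Δ₂ n hn) := by
  intro h k l hh hk hl hpos
  have hΔ : Δ₂ n hn = antisymmetrizer n (secondarySeed ⟨0, by omega⟩ ⟨1, by omega⟩
      (List.ofFn fun i : Fin (n - 3) => ⟨(i : ℕ) + 2, by omega⟩)) := by
    rw [antisymmetrizer_apply, secondarySeed, List.map_ofFn]
    rfl
  rw [hΔ, D_antisymmetrizer n hh hk hl]
  refine antisymmetrizer_D_secondarySeed (m := ⟨n - 1, by omega⟩) ?_ ?_ ?_ ?_ ?_ ?_ ?_ hh hk hl hpos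
  all_goals simp [List.mem_ofFn, List.nodup_ofFn, Function.Injective, Fin.ext_iff]
  all_goals omega
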